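/- arXiv:1112.0647 — 2 statements merged into one kernel-verified Lean document; each statement's English description precedes it below -/
import Mathlib

section
/- Let μ be a complex number and n a positive odd integer. Then b_n(1,0,μ) = det_{1≤i,j≤n}( −δ_{i,j−1} + C(μ+i+j−3, j−1) ) equals ∏_{k=1}^{(n−1)/2} Q3(k) Q4(k), where Q3(k) = 2 (μ/2+2k)_{k+1} (μ+2k+1)_{k−1} / ( (k+1)_k (μ/2+k+1)_k ) and Q4(k) = 2 (μ/2+2k−1)_{k−1} (μ+2k+1)_{k−1} / ( (k)_{k−1} (μ/2+k+1)_{k−1} ); the identity is understood after clearing all denominators (equivalently, it holds whenever all denominators are nonzero). -/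
/-- Generalized binomial coefficient `C(x,k) = x(x-1)⋯(x-k+1)/k!` for complex `x`. -/
noncomputable def gbinom (x : ℂ) (k : ℕ) : ℂ :=
  (∏ i ∈ Finset.range k, (x - i)) / (k.factorial : ℂ)

/-- Pochhammer symbol `(x)_k = x(x+1)⋯(x+k-1)`. -/
noncomputable def poch (x : ℂ) (k : ℕ) : ℂ :=
  ∏ i ∈ Finset.range k, (x + i)
/-- `b_n(I,J,μ)`: determinant of the `n×n` matrix with rows indexed by
`i = I,…,n-1+I`, columns indexed by `j = J,…,n-1+J`, and entries
`-δ_{i,j} + C(μ+i+j-2, j)`. -/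
noncomputable def bdet (μ : ℂ) (n I J : ℕ) : ℂ :=
  Matrix.det (Matrix.of fun i j : Fin n =>
    (if I + i.1 = J + j.1 then (-1 : ℂ) else 0)
      + gbinom (μ + ((I + i.1 : ℕ) : ℂ) + ((J + j.1 : ℕ) : ℂ) - 2) (J + j.1))

noncomputable def Q3 (μ : ℂ) (k : ℕ) : ℂ :=
  2 * poch (μ / 2 + 2 * k) (k + 1) * poch (μ + 2 * k + 1) (k - 1)
    / (poch ((k : ℂ) + 1) k * poch (μ / 2 + k + 1) k)

noncomputable def Q4 (μ : ℂ) (k : ℕ) : ℂ :=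
  2 * poch (μ / 2 + 2 * k - 1) (k - 1) * poch (μ + 2 * k + 1) (k - 1)
    / (poch (k : ℂ) (k - 1) * poch (μ / 2 + k + 1) (k - 1))

/-- The reciprocal Gamma function, an entire function. -/
noncomputable def rGamma (z : ℂ) : ℂ := (Complex.Gamma z)⁻¹

lemma rGamma_eq_mul (z : ℂ) : rGamma z = z * rGamma (z + 1) :=
  Complex.one_div_Gamma_eq_self_mul_one_div_Gamma_add_one z

lemma rGamma_of_eq_neg {z : ℂ} (m : ℕ) (h : z = -m) : rGamma z = 0 := by
  rw [rGamma, h, Complex.Gamma_neg_nat_eq_zero, inv_zero]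

lemma rGamma_of_add_one_eq {z w : ℂ} (h : z + 1 = w) : rGamma z = z * rGamma w := by
  rw [← h, rGamma_eq_mul]

lemma Gamma_of_eq_add_one {z w : ℂ} (h : w = z + 1) (hz : z ≠ 0) :
    Complex.Gamma w = z * Complex.Gamma z := by
  rw [h, Complex.Gamma_add_one z hz]

/-- The building block of the entries of the transformed matrix. -/
noncomputable def gammaEntry (ν k j : ℂ) : ℂ :=
  Complex.Gamma (ν + k + j) * rGamma (2 * j - k + 1) * rGamma (ν + 2 * k - j + 1)

/-- Entries of the upper triangular matrix that triangularises `gammaEntry`. -/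
noncomputable def triEntry (ν c : ℂ) (j : ℕ) : ℂ :=
  (-4) ^ j * Complex.Gamma (j + 1 / 2) * rGamma (c - j + 1) * Complex.Gamma (ν + c + j) *
    rGamma (ν + 2 * c + 1 + j) * Complex.Gamma (ν + 2 * c - j) * rGamma (ν + j)

/-- The telescoping certificate. -/
noncomputable def certEntry (ν c k : ℂ) (j : ℕ) : ℂ :=
  -(3 * k + 2 * ν + 2) * ((-4) ^ j * Complex.Gamma (j + 1 / 2) * rGamma (c - j + 1) *
    Complex.Gamma (ν + c + j) * rGamma (ν + 2 * c + j) * Complex.Gamma (ν + 2 * c - j + 1) *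
    rGamma (ν + j - 1) * Complex.Gamma (ν + k + j) * rGamma (2 * j - k - 1) *
    rGamma (ν + 2 * k - j + 3))

lemma natCast_add_half_ne_zero (m : ℕ) : (m : ℂ) + 1 / 2 ≠ 0 := by
  have : (2 * m + 1 : ℂ) ≠ 0 := by norm_cast
  contrapose! this
  linear_combination 2 * this

lemma certEntry_sub {ν : ℂ} (hν : ∀ q : ℚ, ν + q ≠ 0) (c k j : ℕ) :
    (k + 2 * ν + 2 * c) * (2 * c - k) * (k + 1) *
        ((ν + 3 * j) * gammaEntry ν k j * triEntry ν c j) +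
      -2 * (k + ν + c + 1) * (2 * k + 2 * ν + 1) * (k + 1 - c) *
        ((ν + 3 * j) * gammaEntry ν (k + 1) j * triEntry ν c j) =
      certEntry ν c k (j + 1) - certEntry ν c k j := by
  have n1 : (j : ℂ) + 1 / 2 ≠ 0 := natCast_add_half_ne_zero j
  have n2 : ν + c + j ≠ 0 := by
    have := hν (c + j); push_cast at this; rwa [← add_assoc] at this
  have n3 : ν + 2 * c - j ≠ 0 := by
    have := hν (2 * c - j); push_cast at this; rwa [← add_sub_assoc] at this
  have n4 : ν + k + j ≠ 0 := by
    have := hν (k + j); push_cast at this; rwa [← add_assoc] at this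
  simp only [gammaEntry, triEntry, certEntry]
  push_cast
  rw [Gamma_of_eq_add_one (z := (j : ℂ) + 1 / 2) (w := j + 1 + 1 / 2) (by ring) n1,
    Gamma_of_eq_add_one (z := ν + c + j) (w := ν + c + (j + 1)) (by ring) n2,
    Gamma_of_eq_add_one (z := ν + 2 * c - j) (w := ν + 2 * c - j + 1) (by ring) n3,
    Gamma_of_eq_add_one (z := ν + k + j) (w := ν + (k + 1) + j) (by ring) n4,
    Gamma_of_eq_add_one (z := ν + k + j) (w := ν + k + (j + 1)) (by ring) n4,
    show ν + 2 * (c : ℂ) - (j + 1) + 1 = ν + 2 * c - j by ring,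
    show ν + ((j : ℂ) + 1) - 1 = ν + j by ring,
    show 2 * ((j : ℂ) + 1) - k - 1 = 2 * j - k + 1 by ring,
    show ν + 2 * (c : ℂ) + (j + 1) = ν + 2 * c + 1 + j by ring,
    show 2 * (j : ℂ) - (k + 1) + 1 = 2 * j - k by ring,
    show ν + 2 * ((k : ℂ) + 1) - j + 1 = ν + 2 * k - j + 3 by ring,
    rGamma_of_add_one_eq (z := c - (j + 1) + 1) (w := c - j + 1) (by ring),
    rGamma_of_add_one_eq (z := ν + 2 * c + j) (w := ν + 2 * c + 1 + j) (by ring),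
    rGamma_of_add_one_eq (z := ν + j - 1) (w := ν + j) (by ring),
    rGamma_of_add_one_eq (z := 2 * j - k - 1) (w := 2 * j - k) (by ring),
    rGamma_of_add_one_eq (z := 2 * j - k) (w := 2 * j - k + 1) (by ring),
    rGamma_of_add_one_eq (z := ν + 2 * k - j + 1) (w := ν + 2 * k - j + 2) (by ring),
    rGamma_of_add_one_eq (z := ν + 2 * k - (j + 1) + 3) (w := ν + 2 * k - j + 3) (by ring),
    rGamma_of_add_one_eq (z := ν + 2 * k - j + 2) (w := ν + 2 * k - j + 3) (by ring)]
  ring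

lemma certEntry_zero (ν c : ℂ) (k : ℕ) : certEntry ν c k 0 = 0 := by
  rw [certEntry, rGamma_of_eq_neg (z := 2 * ((0 : ℕ) : ℂ) - k - 1) (k + 1) (by push_cast; ring)]
  ring

lemma certEntry_self_add_one (ν k : ℂ) (c : ℕ) : certEntry ν c k (c + 1) = 0 := by
  rw [certEntry, rGamma_of_eq_neg (z := (c : ℂ) - ((c + 1 : ℕ) : ℂ) + 1) 0 (by push_cast; ring)]
  ring

/-- Entries of the lower triangular product. -/
noncomputable def lowEntry (ν : ℂ) (c k : ℕ) : ℂ :=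
  ∑ j ∈ Finset.range (c + 1), (ν + 3 * j) * gammaEntry ν k j * triEntry ν c j

lemma lowEntry_rec {ν : ℂ} (hν : ∀ q : ℚ, ν + q ≠ 0) (c k : ℕ) :
    (k + 2 * ν + 2 * c) * (2 * c - k) * (k + 1) * lowEntry ν c k =
      2 * (k + ν + c + 1) * (2 * k + 2 * ν + 1) * (k + 1 - c) * lowEntry ν c (k + 1) := by
  have h := Finset.sum_range_sub (certEntry ν c k) (c + 1)
  rw [certEntry_zero, certEntry_self_add_one,
    ← Finset.sum_congr rfl fun j _ => certEntry_sub hν c k j, Finset.sum_add_distrib,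
    ← Finset.mul_sum, ← Finset.mul_sum] at h
  simp only [lowEntry]
  push_cast
  linear_combination h

lemma two_mul_add_ne_zero {ν : ℂ} (hν : ∀ q : ℚ, ν + q ≠ 0) (q : ℚ) : 2 * ν + q ≠ 0 := by
  have := hν (q / 2)
  contrapose! this
  push_cast
  linear_combination this / 2

lemma lowEntry_eq_zero {ν : ℂ} (hν : ∀ q : ℚ, ν + q ≠ 0) {c k : ℕ} (h : k < c) :
    lowEntry ν c k = 0 := by
  have key : ∀ k < c, (k + 1 - c : ℂ) * lowEntry ν c (k + 1) = 0 → lowEntry ν c k = 0 := by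
    intro k hk h0
    have := lowEntry_rec hν c k
    rw [mul_assoc _ ((k : ℂ) + 1 - c), h0, mul_zero] at this
    have n1 : (k + 2 * ν + 2 * c : ℂ) ≠ 0 := by
      have := two_mul_add_ne_zero hν (k + 2 * c)
      contrapose! this
      push_cast
      linear_combination this
    have n2 : (2 * c - k : ℂ) ≠ 0 := by
      rw [sub_ne_zero]
      norm_cast
      omega
    have n3 : (k + 1 : ℂ) ≠ 0 := by norm_cast
    simpa [n1, n2, n3] using this
  obtain ⟨m, rfl⟩ := Nat.exists_eq_add_of_lt h
  clear h
  induction m generalizing k with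
  | zero => exact key k (by omega) (by push_cast; ring)
  | succ m ih =>
    refine key k (by omega) ?_
    have := ih (k := k + 1) (fun k' hk' => by
      have := key k' (by omega)
      rwa [show k + (m + 1) + 1 = k + 1 + m + 1 by ring] at this)
    rw [show k + (m + 1) + 1 = k + 1 + m + 1 by ring, this, mul_zero]

lemma lowEntry_two_mul {ν : ℂ} (hν : ∀ q : ℚ, ν + q ≠ 0) (c : ℕ) :
    lowEntry ν c (2 * c) = triEntry ν c c := by
  have n1 := hν (3 * c)
  push_cast at n1
  rw [lowEntry, Finset.sum_eq_single c]
  · rw [gammaEntry]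
    push_cast
    rw [show 2 * (c : ℂ) - 2 * c + 1 = 1 by ring, show ν + 2 * (c : ℂ) + c = ν + 3 * c by ring,
      show ν + 2 * (2 * (c : ℂ)) - c + 1 = ν + 3 * c + 1 by ring]
    have h1 := rGamma_eq_mul (ν + 3 * c)
    have h2 : Complex.Gamma (ν + 3 * c) * rGamma (ν + 3 * c) = 1 := by
      refine mul_inv_cancel₀ (Complex.Gamma_ne_zero fun m => ?_)
      have := hν (3 * c + m)
      contrapose! this
      push_cast
      linear_combination this
    have h3 : rGamma 1 = 1 := by simp [rGamma]
    rw [h3]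
    linear_combination (triEntry ν c c) * h2 - (triEntry ν c c) * Complex.Gamma (ν + 3 * c) * h1
  · intro j hj hjc
    have : j < c := by simp at hj; omega
    rw [gammaEntry, rGamma_of_eq_neg (z := 2 * (j : ℂ) - ((2 * c : ℕ) : ℂ) + 1)
      (2 * (c - j) - 1)]
    · ring
    · rw [Nat.cast_sub (by omega)]
      push_cast [Nat.cast_sub this.le]
      ring
  · simp

/-- The ratio of diagonal entries. -/
noncomputable def diagRatio (ν : ℂ) (c : ℕ) : ℂ :=
  ∏ i ∈ Finset.range c, 2 * (ν + 2 * c + 1 + i) * (2 * ν + 2 * c + 2 * i + 1) * (i + 1) /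
    ((2 * ν + 3 * c + i) * (c - i) * (c + i + 1))

lemma lowEntry_self {ν : ℂ} (hν : ∀ q : ℚ, ν + q ≠ 0) (c : ℕ) :
    lowEntry ν c c = diagRatio ν c * triEntry ν c c := by
  have h : ∀ m ≤ c, lowEntry ν c c = (∏ i ∈ Finset.range m,
      2 * (ν + 2 * c + 1 + i) * (2 * ν + 2 * c + 2 * i + 1) * (i + 1) /
        ((2 * ν + 3 * c + i) * (c - i) * (c + i + 1))) * lowEntry ν c (c + m) := by
    intro m hm
    induction m with
    | zero => simp
    | succ m ih =>
      rw [ih (by omega), Finset.prod_range_succ, mul_assoc]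
      congr 1
      have n1 : (2 * ν + 3 * c + m : ℂ) ≠ 0 := by
        have := two_mul_add_ne_zero hν (3 * c + m)
        contrapose! this
        push_cast
        linear_combination this
      have n2 : (c - m : ℂ) ≠ 0 := by
        rw [sub_ne_zero]
        norm_cast
        omega
      have n3 : (c + m + 1 : ℂ) ≠ 0 := by norm_cast
      have := lowEntry_rec hν c (c + m)
      push_cast at this
      rw [div_mul_eq_mul_div, eq_div_iff (by simp [n1, n2, n3])]
      rw [← add_assoc c m 1]
      linear_combination this
  rw [h c le_rfl, ← two_mul, lowEntry_two_mul hν, diagRatio]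

lemma triEntry_ne_zero {ν : ℂ} (hν : ∀ q : ℚ, ν + q ≠ 0) (c : ℕ) : triEntry ν c c ≠ 0 := by
  have key : ∀ z : ℂ, (∀ m : ℕ, z + m ≠ 0) → Complex.Gamma z ≠ 0 := fun z hz =>
    Complex.Gamma_ne_zero fun m h => hz m (by rw [h]; ring)
  have k2 : ∀ q : ℚ, Complex.Gamma (ν + q) ≠ 0 := fun q => key _ fun m => by
    have := hν (q + m)
    push_cast at this
    rwa [← add_assoc] at this
  have g1 : Complex.Gamma (c + 1 / 2) ≠ 0 := key _ fun m => by
    have := natCast_add_half_ne_zero (c + m)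
    push_cast at this
    rwa [add_right_comm]
  have g2 := k2 (c + c)
  have g3 := k2 (2 * c + 1 + c)
  have g4 := k2 (2 * c - c)
  have g5 := k2 c
  push_cast at g2 g3 g4 g5
  simp only [triEntry, rGamma]
  rw [show ν + (c : ℂ) + c = ν + (c + c) by ring,
    show ν + 2 * (c : ℂ) + 1 + c = ν + (2 * c + 1 + c) by ring,
    show ν + 2 * (c : ℂ) - c = ν + (2 * c - c) by ring, sub_self, zero_add, Complex.Gamma_one]
  simp only [ne_eq, mul_eq_zero, inv_eq_zero, not_or, g1, g2, g3, g4, g5, not_false_eq_true]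
  simp

lemma triEntry_eq_zero (ν : ℂ) {c j : ℕ} (h : c < j) : triEntry ν c j = 0 := by
  rw [triEntry, rGamma_of_eq_neg (z := (c : ℂ) - j + 1) (j - c - 1)]
  · ring
  · rw [Nat.cast_sub (by omega), Nat.cast_sub h.le]
    push_cast
    ring

lemma det_gammaEntry {ν : ℂ} (hν : ∀ q : ℚ, ν + q ≠ 0) (n : ℕ) :
    Matrix.det (Matrix.of fun k j : Fin n => (ν + 3 * (j : ℕ)) * gammaEntry ν (k : ℕ) (j : ℕ)) =
      ∏ c ∈ Finset.range n, diagRatio ν c := by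
  set D := Matrix.of fun k j : Fin n => (ν + 3 * (j : ℕ)) * gammaEntry ν (k : ℕ) (j : ℕ) with hD
  set E := Matrix.of fun j c : Fin n => triEntry ν (c : ℕ) j with hE
  have hDE : D * E = Matrix.of fun k c : Fin n => lowEntry ν c k := by
    ext k c
    rw [Matrix.mul_apply, Matrix.of_apply, lowEntry]
    simp only [hD, hE, Matrix.of_apply]
    rw [Fin.sum_univ_eq_sum_range
      (fun j => (ν + 3 * (j : ℂ)) * gammaEntry ν (k : ℕ) j * triEntry ν (c : ℕ) j) n]
    symm
    refine Finset.sum_subset (fun j => by simp; omega) fun j _ hj => ?_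
    rw [triEntry_eq_zero ν (by simpa using hj), mul_zero]
  have hEd : E.det = ∏ c : Fin n, triEntry ν (c : ℕ) c := by
    rw [Matrix.det_of_isUpperTriangular]
    · rfl
    · intro i j hij
      exact triEntry_eq_zero ν hij
  have hLd : (D * E).det = ∏ c : Fin n, lowEntry ν c c := by
    rw [hDE, Matrix.det_of_isLowerTriangular]
    · rfl
    · intro i j hij
      exact lowEntry_eq_zero hν hij
  have h0 : E.det ≠ 0 := by
    rw [hEd]
    exact Finset.prod_ne_zero_iff.2 fun c _ => triEntry_ne_zero hν c
  apply mul_right_cancel₀ h0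
  rw [← Matrix.det_mul, hLd, hEd, ← Fin.prod_univ_eq_prod_range, ← Finset.prod_mul_distrib]
  exact Finset.prod_congr rfl fun c _ => lowEntry_self hν c

lemma poch_add (x : ℂ) (m n : ℕ) : poch x (m + n) = poch x m * poch (x + m) n := by
  simp only [poch, Finset.prod_range_add]
  congr 1
  exact Finset.prod_congr rfl fun i _ => by push_cast; ring

lemma poch_one (x : ℂ) : poch x 1 = x := by simp [poch]

lemma poch_two_mul (x : ℂ) (n : ℕ) : poch (2 * x + 1) (2 * n) =
    2 ^ n * poch (x + 1) n * ∏ i ∈ Finset.range n, (2 * x + 2 * i + 1) := by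
  induction n with
  | zero => simp [poch]
  | succ n ih =>
    rw [show 2 * (n + 1) = 2 * n + 1 + 1 by ring, poch_add _ (2 * n + 1), poch_add _ (2 * n), ih,
      poch_add _ n, Finset.prod_range_succ]
    simp only [poch_one]
    push_cast
    ring

lemma poch_ne_zero {x : ℂ} (h : ∀ i : ℕ, x + i ≠ 0) (n : ℕ) : poch x n ≠ 0 :=
  Finset.prod_ne_zero_iff.2 fun i _ => h i

lemma poch_ne_zero_of_generic {ν : ℂ} (hν : ∀ q : ℚ, ν + q ≠ 0) {x : ℂ} (q : ℚ) (h : x = ν + q)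
    (n : ℕ) : poch x n ≠ 0 :=
  poch_ne_zero (fun i => by
    have := hν (q + i)
    push_cast at this
    rwa [h, add_assoc]) n

lemma poch_natCast_add_one_ne_zero (m n : ℕ) : poch ((m : ℂ) + 1) n ≠ 0 :=
  poch_ne_zero (fun i => by norm_cast; omega) n

lemma diagRatio_eq (ν : ℂ) (c : ℕ) : diagRatio ν c = 2 ^ c * poch (ν + 2 * c + 1) c *
    (∏ i ∈ Finset.range c, (2 * (ν + c) + 2 * i + 1)) /
      (poch (2 * ν + 3 * c) c * poch ((c : ℂ) + 1) c) := by
  have h1 : ∏ i ∈ Finset.range c, ((c : ℂ) - i) = ∏ i ∈ Finset.range c, ((i : ℂ) + 1) := by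
    rw [← Finset.prod_range_reflect]
    refine Finset.prod_congr rfl fun i hi => ?_
    have : i + 1 ≤ c := Finset.mem_range.1 hi
    rw [Nat.sub_sub, Nat.cast_sub (by omega)]
    push_cast
    ring
  have h2 : ∏ i ∈ Finset.range c, ((i : ℂ) + 1) ≠ 0 :=
    Finset.prod_ne_zero_iff.2 fun i _ => by norm_cast
  simp only [diagRatio, Finset.prod_div_distrib, Finset.prod_mul_distrib, Finset.prod_const,
    Finset.card_range, h1]
  rw [show (∏ i ∈ Finset.range c, (ν + 2 * (c : ℂ) + 1 + i)) = poch (ν + 2 * c + 1) c from rfl,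
    show (∏ i ∈ Finset.range c, (2 * ν + 3 * (c : ℂ) + i)) = poch (2 * ν + 3 * c) c from rfl,
    show (∏ i ∈ Finset.range c, ((c : ℂ) + i + 1)) = poch ((c : ℂ) + 1) c from
      Finset.prod_congr rfl fun i _ => by ring, mul_right_comm _ _ (poch ((c : ℂ) + 1) c),
    mul_div_mul_right _ _ h2]
  congr 2
  exact Finset.prod_congr rfl fun i _ => by ring

lemma diagRatio_eq_Q3 {ν : ℂ} (hν : ∀ q : ℚ, ν + q ≠ 0) {k : ℕ} (hk : 1 ≤ k) :
    diagRatio ν k = Q3 (2 * ν) k := by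
  obtain ⟨m, rfl⟩ := Nat.exists_eq_add_of_le' hk
  have h1 := poch_two_mul (ν + (m + 1 : ℕ)) (m + 1)
  rw [show 2 * (m + 1) = m + ((m + 1) + 1) by ring, poch_add, poch_add _ (m + 1), poch_one] at h1
  have h2 : poch (ν + 2 * (m + 1 : ℕ)) (m + 1 + 1) =
      (ν + 2 * (m + 1 : ℕ)) * poch (ν + 2 * (m + 1 : ℕ) + 1) (m + 1) := by
    rw [add_comm (m + 1) 1, poch_add, poch_one, Nat.cast_one]
  have e1 : 2 * (ν + ((m + 1 : ℕ) : ℂ)) + 1 = 2 * ν + 2 * (m + 1 : ℕ) + 1 := by ring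
  have e2 : 2 * ν + 2 * ((m + 1 : ℕ) : ℂ) + 1 + m = 2 * ν + 3 * (m + 1 : ℕ) := by
    push_cast; ring
  rw [e1, e2] at h1
  have n1 : poch (ν + ((m + 1 : ℕ) : ℂ) + 1) (m + 1) ≠ 0 :=
    poch_ne_zero_of_generic hν (m + 2) (by push_cast; ring) _
  have n2 := poch_natCast_add_one_ne_zero (m + 1) (m + 1)
  have n3 : poch (2 * ν + 3 * ((m + 1 : ℕ) : ℂ)) (m + 1) ≠ 0 :=
    poch_ne_zero_of_generic (two_mul_add_ne_zero hν) (3 * (m + 1)) (by push_cast; ring) _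
  rw [diagRatio_eq, Q3, mul_div_cancel_left₀ ν two_ne_zero, h2, Nat.add_sub_cancel,
    div_eq_div_iff (mul_ne_zero n3 n2) (mul_ne_zero n2 n1)]
  linear_combination (-poch (ν + 2 * (m + 1 : ℕ) + 1) (m + 1) * poch ((m + 1 : ℕ) + 1) (m + 1)) * h1

lemma diagRatio_eq_Q4 {ν : ℂ} (hν : ∀ q : ℚ, ν + q ≠ 0) (m : ℕ) :
    (2 * ν + 2 + 3 * m) * diagRatio (ν + 1) m = (ν + 1 + 3 * m) * Q4 (2 * ν) (m + 1) := by
  have h1 := poch_two_mul (ν + 1 + m) m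
  have e1 : 2 * (ν + 1 + (m : ℂ)) + 1 = 2 * ν + 2 * (m + 1 : ℕ) + 1 := by push_cast; ring
  have e2 : 2 * ν + 2 * ((m + 1 : ℕ) : ℂ) + 1 + m = 2 * (ν + 1) + 3 * m + 1 := by
    push_cast; ring
  have e3 : ν + ((m + 1 : ℕ) : ℂ) + 1 = ν + 1 + m + 1 := by push_cast; ring
  have e4 : ν + 2 * ((m + 1 : ℕ) : ℂ) - 1 = ν + 1 + 2 * m := by push_cast; ring
  rw [two_mul m, poch_add, e1, e2] at h1
  have h2 : (2 * (ν + 1) + 3 * m) * poch (2 * (ν + 1) + 3 * m + 1) m =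
      poch (2 * (ν + 1) + 3 * m) m * (2 * (ν + 1) + 3 * m + m) := by
    have := poch_add (2 * (ν + 1) + 3 * m) 1 m
    rw [add_comm 1 m, poch_add, poch_one, poch_one, Nat.cast_one] at this
    exact this.symm
  have h3 : (ν + 1 + 2 * m) * poch (ν + 1 + 2 * m + 1) m =
      poch (ν + 1 + 2 * m) m * (ν + 1 + 2 * m + m) := by
    have := poch_add (ν + 1 + 2 * m) 1 m
    rw [add_comm 1 m, poch_add, poch_one, poch_one, Nat.cast_one] at this
    exact this.symm
  have n1 : poch (ν + 1 + (m : ℂ) + 1) m ≠ 0 :=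
    poch_ne_zero_of_generic hν (m + 2) (by push_cast; ring) _
  have n2 := poch_natCast_add_one_ne_zero m m
  have n3 : poch (2 * (ν + 1) + 3 * (m : ℂ)) m ≠ 0 :=
    poch_ne_zero_of_generic (two_mul_add_ne_zero hν) (3 * m + 2) (by push_cast; ring) _
  rw [diagRatio_eq, Q4, mul_div_cancel_left₀ ν two_ne_zero, Nat.add_sub_cancel, e3, e4,
    Nat.cast_succ m, ← mul_div_assoc, ← mul_div_assoc,
    div_eq_div_iff (mul_ne_zero n3 n2) (mul_ne_zero n2 n1)]
  set P := poch ((m : ℂ) + 1) m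
  set A := poch (ν + 1 + 2 * m + 1) m
  set B := poch (2 * (ν + 1) + 3 * (m : ℂ)) m
  set C := poch (2 * (ν + 1) + 3 * (m : ℂ) + 1) m
  set D := poch (2 * ν + 2 * ((m + 1 : ℕ) : ℂ) + 1) m
  have e5 : 2 * ν + 2 * ((m : ℂ) + 1) + 1 = 2 * ν + 2 * ((m + 1 : ℕ) : ℂ) + 1 := by
    push_cast; ring
  rw [e5]
  linear_combination (-(2 * ν + 2 + 3 * m) * A * P) * h1 + A * P * D * h2 + 2 * B * P * D * h3

section

open PowerSeries

variable {ν : ℂ}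

/-- The power series `(1 - X)⁻ᶜ`. -/
noncomputable def negPow (c : ℂ) : ℂ⟦X⟧ := PowerSeries.mk fun l => poch c l / l.factorial

lemma poch_succ_right (x : ℂ) (n : ℕ) : poch x (n + 1) = poch x n * (x + n) :=
  Finset.prod_range_succ _ _

lemma poch_succ_left (x : ℂ) (n : ℕ) : poch x (n + 1) = x * poch (x + 1) n := by
  rw [poch, Finset.prod_range_succ', mul_comm, Nat.cast_zero, add_zero, poch]
  congr 1
  exact Finset.prod_congr rfl fun i _ => by push_cast; ring

lemma gbinom_eq_poch (c : ℂ) (l : ℕ) : gbinom (c + l - 1) l = poch c l / l.factorial := by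
  rw [gbinom, poch, ← Finset.prod_range_reflect]
  congr 1
  refine Finset.prod_congr rfl fun i hi => ?_
  have : i + 1 ≤ l := Finset.mem_range.1 hi
  rw [Nat.sub_sub, Nat.cast_sub (by omega)]
  push_cast
  ring

lemma one_sub_X_mul_negPow (c : ℂ) : (1 - X) * negPow (c + 1) = negPow c := by
  ext l
  rw [sub_mul, one_mul, map_sub]
  cases l with
  | zero => simp [negPow, poch]
  | succ l =>
    rw [coeff_succ_X_mul]
    simp only [negPow, coeff_mk]
    rw [poch_succ_right, poch_succ_left, Nat.factorial_succ]
    have : (l.factorial : ℂ) ≠ 0 := by exact_mod_cast l.factorial_ne_zero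
    have : ((l + 1 : ℕ) : ℂ) ≠ 0 := by norm_cast
    push_cast at *
    field_simp
    ring

lemma derivative_negPow (c : ℂ) : derivative ℂ (negPow c) = PowerSeries.C c * negPow (c + 1) := by
  ext l
  rw [coeff_derivative, coeff_C_mul]
  simp only [negPow, coeff_mk]
  rw [poch_succ_left, Nat.factorial_succ]
  have : (l.factorial : ℂ) ≠ 0 := by exact_mod_cast l.factorial_ne_zero
  have : ((l + 1 : ℕ) : ℂ) ≠ 0 := by norm_cast
  push_cast at *
  field_simp

lemma negPow_zero : negPow 0 = 1 := by
  ext l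
  cases l with
  | zero => simp [negPow, poch]
  | succ l => simp [negPow, poch_succ_left, coeff_one]

lemma one_sub_X_mul_negPow_one : (1 - X) * negPow 1 = 1 := by
  simpa [negPow_zero] using one_sub_X_mul_negPow 0

lemma negPow_add_natCast (c : ℂ) (k : ℕ) : negPow (c + k) = negPow c * negPow 1 ^ k := by
  induction k with
  | zero => simp
  | succ k ih =>
    have h1 := one_sub_X_mul_negPow (c + k)
    have h2 := one_sub_X_mul_negPow_one
    rw [Nat.cast_succ, ← add_assoc, pow_succ, ← mul_assoc, ← ih, ← h1]
    linear_combination (-negPow (c + k + 1)) * h2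

lemma negPow_add_one (c : ℂ) : negPow (c + 1) = negPow c * negPow 1 := by
  simpa using negPow_add_natCast c 1

lemma coeff_X_mul_derivative (P : ℂ⟦X⟧) (l : ℕ) :
    coeff l (X * derivative ℂ P) = l * coeff l P := by
  cases l with
  | zero => simp
  | succ l => rw [coeff_succ_X_mul, coeff_derivative]; push_cast; ring

lemma eq_negPow_of_derivative {c a : ℂ} {W : ℂ⟦X⟧}
    (h : (1 - X) * derivative ℂ W = PowerSeries.C c * W) (h0 : constantCoeff W = a) :
    W = PowerSeries.C a * negPow c := by
  ext l
  induction l with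
  | zero => simp [h0, negPow, poch]
  | succ l ih =>
    have h1 := congrArg (coeff l) h
    rw [sub_mul, one_mul, map_sub, coeff_C_mul, coeff_derivative] at h1
    rw [coeff_X_mul_derivative] at h1
    rw [coeff_C_mul] at ih ⊢
    have n1 : (l + 1 : ℂ) ≠ 0 := by norm_cast
    apply mul_right_cancel₀ n1
    have : (l.factorial : ℂ) ≠ 0 := by exact_mod_cast l.factorial_ne_zero
    have h3 : coeff (l + 1) (negPow c) * (l + 1) = (c + l) * coeff l (negPow c) := by
      simp only [negPow, coeff_mk]
      rw [poch_succ_right, Nat.factorial_succ]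
      push_cast
      field_simp
    rw [mul_assoc, h3]
    linear_combination h1 + (c + l) * ih

/-- The series `X² / (1 - X)`. -/
noncomputable def quadArg : ℂ⟦X⟧ := X ^ 2 * negPow 1

lemma hasSubst_quadArg : HasSubst quadArg :=
  HasSubst.of_constantCoeff_zero' (by simp [quadArg])

/-- Substitution of `X² / (1 - X)`. -/
noncomputable def quadSubst : ℂ⟦X⟧ →ₐ[ℂ] ℂ⟦X⟧ := substAlgHom hasSubst_quadArg

lemma quadSubst_X : quadSubst X = quadArg := by
  rw [quadSubst, substAlgHom_X]

lemma quadSubst_C (a : ℂ) : quadSubst (PowerSeries.C a) = PowerSeries.C a :=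
  quadSubst.commutes a

lemma derivative_quadSubst (P : ℂ⟦X⟧) : derivative ℂ (quadSubst P) =
    quadSubst (derivative ℂ P) * ((2 * X - X ^ 2) * negPow 1 ^ 2) := by
  rw [quadSubst, coe_substAlgHom, derivative_subst hasSubst_quadArg]
  congr 1
  have h := one_sub_X_mul_negPow_one
  rw [quadArg, Derivation.leibniz, Derivation.leibniz_pow, derivative_negPow, derivative_X,
    negPow_add_one]
  simp
  linear_combination (-2 * X * negPow 1) * h

/-- The power series whose coefficients are the values of `a` at natural numbers. -/
noncomputable def seqSeries (a : ℂ → ℂ) : ℂ⟦X⟧ := PowerSeries.mk fun j => a j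

lemma X_mul_seqSeries {a : ℂ → ℂ} (h : a (-1) = 0) :
    X * seqSeries a = seqSeries fun j => a (j - 1) := by
  ext l
  cases l with
  | zero => simp [seqSeries, h]
  | succ l => simp [seqSeries, coeff_succ_X_mul]

lemma X_sq_mul_seqSeries {a : ℂ → ℂ} (h : a (-1) = 0) (h2 : a (-2) = 0) :
    X ^ 2 * seqSeries a = seqSeries fun j => a (j - 2) := by
  rw [pow_two, mul_assoc, X_mul_seqSeries h, X_mul_seqSeries (by norm_num [h2])]
  congr 1
  ext j
  rw [show j - 1 - 1 = j - 2 by ring]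

/-- Coefficients of the odd rows. -/
noncomputable def oddCoeff (ν k j : ℂ) : ℂ :=
  (2 * ν - 1 + 3 * k) * (Complex.Gamma (ν + k + j) * rGamma (2 * j + 2 - k) *
    rGamma (ν + 2 * k - j))

/-- Coefficients of the even rows. -/
noncomputable def evenCoeff (ν k j : ℂ) : ℂ := (ν + 3 * j) * gammaEntry ν k j

/-- Coefficients of the auxiliary even series at `k = 0`. -/
noncomputable def auxCoeff (ν j : ℂ) : ℂ :=
  2 * (Complex.Gamma (ν + j) * rGamma (2 * j + 1) * rGamma (ν - j))

lemma oddCoeff_neg_one (ν : ℂ) (k : ℕ) : oddCoeff ν k (-1) = 0 := by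
  rw [oddCoeff, rGamma_of_eq_neg (z := 2 * (-1) + 2 - (k : ℂ)) k (by ring)]
  ring

lemma oddCoeff_neg_two (ν : ℂ) (k : ℕ) : oddCoeff ν k (-2) = 0 := by
  rw [oddCoeff, rGamma_of_eq_neg (z := 2 * (-2) + 2 - (k : ℂ)) (k + 2) (by push_cast; ring)]
  ring

lemma evenCoeff_neg_one (ν : ℂ) (k : ℕ) : evenCoeff ν k (-1) = 0 := by
  rw [evenCoeff, gammaEntry,
    rGamma_of_eq_neg (z := 2 * (-1) - (k : ℂ) + 1) (k + 1) (by push_cast; ring)]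
  ring

lemma evenCoeff_neg_two (ν : ℂ) (k : ℕ) : evenCoeff ν k (-2) = 0 := by
  rw [evenCoeff, gammaEntry,
    rGamma_of_eq_neg (z := 2 * (-2) - (k : ℂ) + 1) (k + 3) (by push_cast; ring)]
  ring

lemma auxCoeff_neg_one (ν : ℂ) : auxCoeff ν (-1) = 0 := by
  rw [auxCoeff, rGamma_of_eq_neg (z := 2 * (-1) + 1) 1 (by push_cast; ring)]
  ring

lemma oddCoeff_succ (hν : ∀ q : ℚ, ν + q ≠ 0) (k j : ℕ) :
    oddCoeff ν (k + 1) j = -(1 / 2) * oddCoeff ν k (j - 1) + 2 * evenCoeff ν k j +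
      1 / 2 * evenCoeff ν k (j - 1) := by
  have n1 : ν + k + (j - 1) ≠ 0 := by
    have := hν (k + (j - 1)); push_cast at this; rwa [← add_assoc] at this
  have n2 : ν + k + j ≠ 0 := by
    have := hν (k + j); push_cast at this; rwa [← add_assoc] at this
  simp only [oddCoeff, evenCoeff, gammaEntry]
  rw [Gamma_of_eq_add_one (z := ν + k + j) (w := ν + (k + 1) + j) (by ring) n2,
    Gamma_of_eq_add_one (z := ν + k + (j - 1)) (w := ν + k + j) (by ring) n1,
    show 2 * (j : ℂ) + 2 - (k + 1) = 2 * j - k + 1 by ring,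
    show 2 * ((j : ℂ) - 1) + 2 - k = 2 * j - k by ring,
    show 2 * ((j : ℂ) - 1) - k + 1 = 2 * j - k - 1 by ring,
    show ν + 2 * ((k : ℂ) + 1) - j = ν + 2 * k - j + 2 by ring,
    show ν + 2 * (k : ℂ) - (j - 1) = ν + 2 * k - j + 1 by ring,
    rGamma_of_add_one_eq (z := 2 * j - k - 1) (w := 2 * j - k) (by ring),
    rGamma_of_add_one_eq (z := 2 * j - k) (w := 2 * j - k + 1) (by ring),
    rGamma_of_add_one_eq (z := ν + 2 * k - j + 1) (w := ν + 2 * k - j + 2) (by ring),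
    show ν + 2 * (k : ℂ) - j + 1 + 1 = ν + 2 * k - j + 2 by ring]
  ring

lemma evenCoeff_succ (hν : ∀ q : ℚ, ν + q ≠ 0) (k j : ℕ) :
    evenCoeff ν (k + 1) j = 7 / 2 * evenCoeff ν k (j - 1) + evenCoeff ν k (j - 2) +
      1 / 2 * oddCoeff ν k (j - 1) - oddCoeff ν k (j - 2) := by
  have n1 : ν + k + (j - 1) ≠ 0 := by
    have := hν (k + (j - 1)); push_cast at this; rwa [← add_assoc] at this
  have n2 : ν + k + j ≠ 0 := by
    have := hν (k + j); push_cast at this; rwa [← add_assoc] at this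
  have n3 : ν + k + (j - 2) ≠ 0 := by
    have := hν (k + (j - 2)); push_cast at this; rwa [← add_assoc] at this
  simp only [oddCoeff, evenCoeff, gammaEntry]
  rw [Gamma_of_eq_add_one (z := ν + k + j) (w := ν + (k + 1) + j) (by ring) n2,
    Gamma_of_eq_add_one (z := ν + k + (j - 1)) (w := ν + k + j) (by ring) n1,
    Gamma_of_eq_add_one (z := ν + k + (j - 2)) (w := ν + k + (j - 1)) (by ring) n3,
    show 2 * (j : ℂ) - (k + 1) + 1 = 2 * j - k by ring,
    show 2 * ((j : ℂ) - 1) + 2 - k = 2 * j - k by ring,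
    show 2 * ((j : ℂ) - 2) + 2 - k = 2 * j - k - 2 by ring,
    show 2 * ((j : ℂ) - 1) - k + 1 = 2 * j - k - 1 by ring,
    show 2 * ((j : ℂ) - 2) - k + 1 = 2 * j - k - 3 by ring,
    show ν + 2 * ((k : ℂ) + 1) - j + 1 = ν + 2 * k - j + 3 by ring,
    show ν + 2 * (k : ℂ) - (j - 1) + 1 = ν + 2 * k - j + 2 by ring,
    show ν + 2 * (k : ℂ) - (j - 2) + 1 = ν + 2 * k - j + 3 by ring,
    show ν + 2 * (k : ℂ) - (j - 1) = ν + 2 * k - j + 1 by ring,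
    show ν + 2 * (k : ℂ) - (j - 2) = ν + 2 * k - j + 2 by ring,
    rGamma_of_add_one_eq (z := 2 * j - k - 3) (w := 2 * j - k - 2) (by ring),
    rGamma_of_add_one_eq (z := 2 * j - k - 2) (w := 2 * j - k - 1) (by ring),
    rGamma_of_add_one_eq (z := 2 * j - k - 1) (w := 2 * j - k) (by ring),
    rGamma_of_add_one_eq (z := ν + 2 * k - j + 1) (w := ν + 2 * k - j + 2) (by ring),
    rGamma_of_add_one_eq (z := ν + 2 * k - j + 2) (w := ν + 2 * k - j + 3) (by ring)]
  ring

lemma oddCoeff_zero_mul (j : ℕ) :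
    oddCoeff ν 0 j * (2 * j + 1) = (ν - 1 / 2) * auxCoeff ν j := by
  simp only [oddCoeff, auxCoeff]
  rw [rGamma_of_add_one_eq (z := 2 * j + 1) (w := 2 * j + 2) (by ring)]
  simp only [mul_zero, add_zero, sub_zero]
  ring

lemma auxCoeff_succ (hν : ∀ q : ℚ, ν + q ≠ 0) (j : ℕ) :
    auxCoeff ν (j + 1) * (2 * j + 2) + auxCoeff ν j * (2 * j + 1) / 4 =
      (ν - 1 / 2) * oddCoeff ν 0 j := by
  have n1 : ν + j ≠ 0 := hν j
  simp only [oddCoeff, auxCoeff]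
  rw [Gamma_of_eq_add_one (z := ν + j) (w := ν + (j + 1)) (by ring) n1,
    rGamma_of_add_one_eq (z := 2 * j + 1) (w := 2 * j + 2) (by ring),
    rGamma_of_add_one_eq (z := 2 * j + 2) (w := 2 * (j + 1) + 1) (by ring),
    rGamma_of_add_one_eq (z := ν - (j + 1)) (w := ν - j) (by ring)]
  simp only [mul_zero, add_zero, sub_zero]
  rw [rGamma_of_add_one_eq (z := 2 * (j : ℂ) + 2) (w := 2 * (j + 1) + 1) (by ring)]
  ring

lemma auxCoeff_zero (hν : ∀ q : ℚ, ν + q ≠ 0) : auxCoeff ν 0 = 2 := by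
  have h : Complex.Gamma ν * rGamma ν = 1 := by
    refine mul_inv_cancel₀ (Complex.Gamma_ne_zero fun m => ?_)
    have := hν m
    contrapose! this
    push_cast
    linear_combination this
  have h3 : rGamma 1 = 1 := by simp [rGamma]
  simp [auxCoeff, h3, h]

lemma evenCoeff_zero (hν : ∀ q : ℚ, ν + q ≠ 0) (j : ℕ) :
    2 * evenCoeff ν 0 j = 2 * oddCoeff ν 0 (j - 1) + auxCoeff ν j + auxCoeff ν (j - 1) := by
  have n1 : ν + (j - 1) ≠ 0 := by
    have := hν (j - 1); push_cast at this; exact this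
  simp only [oddCoeff, evenCoeff, gammaEntry, auxCoeff, mul_zero, add_zero, sub_zero]
  rw [Gamma_of_eq_add_one (z := ν + (j - 1)) (w := ν + j) (by ring) n1,
    show 2 * ((j : ℂ) - 1) + 2 = 2 * j by ring,
    show 2 * ((j : ℂ) - 1) + 1 = 2 * j - 1 by ring,
    rGamma_of_add_one_eq (z := 2 * j - 1) (w := 2 * j) (by ring),
    rGamma_of_add_one_eq (z := 2 * j) (w := 2 * j + 1) (by ring),
    show ν - ((j : ℂ) - 1) = ν - j + 1 by ring,
    rGamma_of_add_one_eq (z := ν - j) (w := ν - j + 1) (by ring)]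
  ring

/-- Series attached to the odd rows. -/
noncomputable def oddSeries (ν : ℂ) (k : ℕ) : ℂ⟦X⟧ :=
  (X * negPow 1 ^ 2) ^ k * negPow (2 * ν - 1) - (-X * (1 - X)) ^ k

/-- Series attached to the even rows. -/
noncomputable def evenSeries (ν : ℂ) (k : ℕ) : ℂ⟦X⟧ :=
  PowerSeries.C (1 / 2) * ((1 + X) * negPow 1 * (X * negPow 1 ^ 2) ^ k * negPow (2 * ν - 1) +
    (1 - 2 * X) * (-X * (1 - X)) ^ k)

lemma C_half_mul_two : PowerSeries.C (1 / 2 : ℂ) * 2 = 1 := by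
  rw [show (2 : ℂ⟦X⟧) = PowerSeries.C (2 : ℂ) from (map_ofNat _ 2).symm, ← map_mul]
  norm_num

lemma oddSeries_succ (ν : ℂ) (k : ℕ) : oddSeries ν (k + 1) =
    -(PowerSeries.C (1 / 2) * quadArg) * oddSeries ν k +
      2 * (X * (1 - PowerSeries.C (1 / 2) * X) * negPow 1) * evenSeries ν k := by
  have h := one_sub_X_mul_negPow_one
  have h2 := C_half_mul_two
  rw [oddSeries, oddSeries, evenSeries, quadArg, pow_succ (X * negPow 1 ^ 2) k,
    pow_succ (-X * (1 - X)) k]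
  generalize (X * negPow 1 ^ 2) ^ k = A at *
  generalize (-X * (1 - X) : ℂ⟦X⟧) ^ k = B at *
  generalize negPow (2 * ν - 1) = F at *
  generalize negPow 1 = g at *
  generalize PowerSeries.C (1 / 2 : ℂ) = c at *
  generalize (X : ℂ⟦X⟧) = x at *
  have e1 : x * g ^ 2 = -(c * (x ^ 2 * g)) + 2 * (x * (1 - c * x) * g) * (c * ((1 + x) * g)) := by
    grind
  have e2 : -x * (1 - x) = -(c * (x ^ 2 * g)) - 2 * (x * (1 - c * x) * g) * (c * (1 - 2 * x)) := by
    grind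
  linear_combination A * F * e1 - B * e2

lemma evenSeries_succ (ν : ℂ) (k : ℕ) : evenSeries ν (k + 1) =
    -(PowerSeries.C (1 / 2) * quadArg) * evenSeries ν k +
      4 * (X * (1 - PowerSeries.C (1 / 2) * X) * negPow 1) ^ 2 * evenSeries ν k +
      PowerSeries.C (1 / 2) * (X * (1 - PowerSeries.C (1 / 2) * X) * negPow 1) *
        (1 - 2 * quadArg) * oddSeries ν k := by
  have h := one_sub_X_mul_negPow_one
  have h2 := C_half_mul_two
  rw [oddSeries, evenSeries, evenSeries, quadArg, pow_succ (X * negPow 1 ^ 2) k,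
    pow_succ (-X * (1 - X)) k]
  generalize (X * negPow 1 ^ 2) ^ k = A at *
  generalize (-X * (1 - X) : ℂ⟦X⟧) ^ k = B at *
  generalize negPow (2 * ν - 1) = F at *
  generalize negPow 1 = g at *
  generalize PowerSeries.C (1 / 2 : ℂ) = c at *
  generalize (X : ℂ⟦X⟧) = x at *
  have e1 : c * ((1 + x) * g) * (x * g ^ 2) = -(c * (x ^ 2 * g)) * (c * ((1 + x) * g)) +
      4 * (x * (1 - c * x) * g) ^ 2 * (c * ((1 + x) * g)) +
      c * (x * (1 - c * x) * g) * (1 - 2 * (x ^ 2 * g)) := by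
    grind
  have e2 : c * (1 - 2 * x) * (-x * (1 - x)) = -(c * (x ^ 2 * g)) * (c * (1 - 2 * x)) +
      4 * (x * (1 - c * x) * g) ^ 2 * (c * (1 - 2 * x)) -
      c * (x * (1 - c * x) * g) * (1 - 2 * (x ^ 2 * g)) := by
    grind
  linear_combination A * F * e1 + B * e2

lemma seqSeries_oddCoeff_succ (hν : ∀ q : ℚ, ν + q ≠ 0) (k : ℕ) :
    seqSeries (oddCoeff ν (k + 1)) = -(PowerSeries.C (1 / 2) * X) * seqSeries (oddCoeff ν k) +
      (2 + PowerSeries.C (1 / 2) * X) * seqSeries (evenCoeff ν k) := by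
  rw [show (2 : ℂ⟦X⟧) = PowerSeries.C (2 : ℂ) from (map_ofNat _ 2).symm, add_mul, neg_mul,
    mul_assoc, mul_assoc, X_mul_seqSeries (oddCoeff_neg_one ν k),
    X_mul_seqSeries (evenCoeff_neg_one ν k)]
  ext j
  simp only [map_add, map_neg, coeff_C_mul, seqSeries, coeff_mk]
  linear_combination oddCoeff_succ hν k j

lemma seqSeries_evenCoeff_succ (hν : ∀ q : ℚ, ν + q ≠ 0) (k : ℕ) :
    seqSeries (evenCoeff ν (k + 1)) =
      (PowerSeries.C (7 / 2) * X + X ^ 2) * seqSeries (evenCoeff ν k) +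
      (PowerSeries.C (1 / 2) * X - X ^ 2) * seqSeries (oddCoeff ν k) := by
  rw [add_mul, sub_mul, mul_assoc, mul_assoc, X_mul_seqSeries (oddCoeff_neg_one ν k),
    X_mul_seqSeries (evenCoeff_neg_one ν k),
    X_sq_mul_seqSeries (oddCoeff_neg_one ν k) (oddCoeff_neg_two ν k),
    X_sq_mul_seqSeries (evenCoeff_neg_one ν k) (evenCoeff_neg_two ν k)]
  ext j
  simp only [map_add, map_sub, coeff_C_mul, seqSeries, coeff_mk]
  linear_combination evenCoeff_succ hν k j

lemma seqSeries_evenCoeff_zero (hν : ∀ q : ℚ, ν + q ≠ 0) :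
    2 * seqSeries (evenCoeff ν 0) =
      2 * X * seqSeries (oddCoeff ν 0) + (1 + X) * seqSeries (auxCoeff ν) := by
  have h := oddCoeff_neg_one ν 0
  rw [Nat.cast_zero] at h
  rw [show (2 : ℂ⟦X⟧) = PowerSeries.C (2 : ℂ) from (map_ofNat _ 2).symm, add_mul, mul_assoc,
    one_mul, X_mul_seqSeries h, X_mul_seqSeries (auxCoeff_neg_one ν)]
  ext j
  simp only [map_add, coeff_C_mul, seqSeries, coeff_mk]
  linear_combination evenCoeff_zero hν j

lemma derivative_seqSeries_oddCoeff_zero (ν : ℂ) :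
    seqSeries (oddCoeff ν 0) + 2 * (X * derivative ℂ (seqSeries (oddCoeff ν 0))) =
      PowerSeries.C (ν - 1 / 2) * seqSeries (auxCoeff ν) := by
  rw [show (2 : ℂ⟦X⟧) = PowerSeries.C (2 : ℂ) from (map_ofNat _ 2).symm]
  ext j
  rw [map_add, coeff_C_mul, coeff_C_mul, coeff_X_mul_derivative]
  simp only [seqSeries, coeff_mk]
  linear_combination oddCoeff_zero_mul (ν := ν) j

lemma derivative_seqSeries_auxCoeff (hν : ∀ q : ℚ, ν + q ≠ 0) :
    2 * derivative ℂ (seqSeries (auxCoeff ν)) + PowerSeries.C (1 / 4) *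
      (seqSeries (auxCoeff ν) + 2 * (X * derivative ℂ (seqSeries (auxCoeff ν)))) =
      PowerSeries.C (ν - 1 / 2) * seqSeries (oddCoeff ν 0) := by
  rw [show (2 : ℂ⟦X⟧) = PowerSeries.C (2 : ℂ) from (map_ofNat _ 2).symm]
  ext j
  rw [map_add, coeff_C_mul, coeff_C_mul, coeff_C_mul, map_add, coeff_C_mul,
    coeff_X_mul_derivative, coeff_derivative]
  simp only [seqSeries, coeff_mk]
  have := auxCoeff_succ hν j
  push_cast
  linear_combination this

lemma constantCoeff_quadSubst (P : ℂ⟦X⟧) : constantCoeff (quadSubst P) = constantCoeff P := by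
  conv_lhs => rw [eq_X_mul_shift_add_const P]
  simp [quadSubst_X, quadSubst_C, quadArg]

lemma base_series (hν : ∀ q : ℚ, ν + q ≠ 0) :
    X * negPow ν * quadSubst (seqSeries (oddCoeff ν 0)) = negPow (2 * ν - 1) - 1 ∧
    (1 - PowerSeries.C (1 / 2) * X) * negPow ν * quadSubst (seqSeries (auxCoeff ν)) =
      negPow (2 * ν - 1) + 1 := by
  have h1 := congrArg quadSubst (derivative_seqSeries_oddCoeff_zero ν)
  have h2 := congrArg quadSubst (derivative_seqSeries_auxCoeff hν)
  simp only [map_add, map_mul, quadSubst_X, quadSubst_C, map_ofNat, quadArg] at h1 h2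
  set P := quadSubst (seqSeries (oddCoeff ν 0)) with hP
  set Q := quadSubst (seqSeries (auxCoeff ν)) with hQ
  have dP := derivative_quadSubst (seqSeries (oddCoeff ν 0))
  have dQ := derivative_quadSubst (seqSeries (auxCoeff ν))
  set P' := quadSubst (derivative ℂ (seqSeries (oddCoeff ν 0)))
  set Q' := quadSubst (derivative ℂ (seqSeries (auxCoeff ν)))
  rw [← hP] at dP
  rw [← hQ] at dQ
  have hg := one_sub_X_mul_negPow_one
  have h4 := C_half_mul_two
  have h5 : PowerSeries.C (1 / 4 : ℂ) = PowerSeries.C (1 / 2) * PowerSeries.C (1 / 2) := by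
    rw [← map_mul]; norm_num
  have h6 : PowerSeries.C (ν - 1 / 2) = PowerSeries.C ν - PowerSeries.C (1 / 2) := map_sub _ _ _
  rw [h6] at h1 h2
  rw [h5] at h2
  set U := X * negPow ν * P with hU
  set V := (1 - PowerSeries.C (1 / 2) * X) * negPow ν * Q with hV
  have dU : (1 - X) * derivative ℂ U = PowerSeries.C (ν - 1 / 2) * (U + V) := by
    rw [hU, Derivation.leibniz, Derivation.leibniz, derivative_X, derivative_negPow,
      negPow_add_one, dP, hV]
    simp only [smul_eq_mul]
    rw [h6]
    generalize negPow ν = f at *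
    generalize negPow 1 = g at *
    generalize PowerSeries.C ν = n at *
    generalize PowerSeries.C (1 / 2 : ℂ) = c at *
    linear_combination f * (1 - c * X) * h1 +
      f * (n * X * P + (2 * X ^ 2 - X ^ 3) * g * P') * hg + f * X * (P + X ^ 2 * g * P') * h4
  have dV : (1 - X) * derivative ℂ V = PowerSeries.C (ν - 1 / 2) * (U + V) := by
    rw [hV, Derivation.leibniz, Derivation.leibniz, map_sub, Derivation.leibniz, derivative_X,
      derivative_negPow, negPow_add_one, dQ, hU, derivative_C, Derivation.map_one_eq_zero]
    simp only [smul_eq_mul]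
    rw [h6]
    generalize negPow ν = f at *
    generalize negPow 1 = g at *
    generalize PowerSeries.C ν = n at *
    generalize PowerSeries.C (1 / 2 : ℂ) = c at *
    have e : (1 - c * X) * (2 - X) * g = 2 + 2 * (c * c) * (X ^ 2 * g) := by
      clear * - hg h4
      grind
    linear_combination f * X * h2 + ((1 - c * X) * f * (2 * X - X ^ 2) * g * Q' +
      Q * (1 - c * X) * n * f) * hg + f * X * Q' * e - c * X * f * Q * h4
  have cU : constantCoeff U = 0 := by simp [hU]
  have cV : constantCoeff V = 2 := by
    rw [hV, map_mul, hQ, constantCoeff_quadSubst, seqSeries, ← coeff_zero_eq_constantCoeff_apply,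
      ← coeff_zero_eq_constantCoeff_apply, coeff_mk, Nat.cast_zero, auxCoeff_zero hν]
    simp [negPow, poch]
  have sum : U + V = PowerSeries.C 2 * negPow (2 * ν - 1) := by
    apply eq_negPow_of_derivative
    · rw [map_add, mul_add, dU, dV, ← add_mul, ← map_add]
      congr 2
      ring
    · rw [map_add, cU, cV, zero_add]
  have dif : V - U = 2 := by
    have n1 : (1 - X : ℂ⟦X⟧) ≠ 0 := left_ne_zero_of_mul_eq_one hg
    apply derivative.ext
    · apply mul_left_cancel₀ n1
      rw [map_sub, mul_sub, dU, dV, sub_self, show (2 : ℂ⟦X⟧) = PowerSeries.C (2 : ℂ) from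
        (map_ofNat _ 2).symm, derivative_C, mul_zero]
    · rw [map_sub, cU, cV, sub_zero, map_ofNat]
  have h2' : PowerSeries.C (2 : ℂ) = 2 := map_ofNat _ 2
  rw [h2'] at sum
  have n2 : (2 : ℂ⟦X⟧) ≠ 0 := right_ne_zero_of_mul_eq_one h4
  constructor
  · apply mul_left_cancel₀ n2
    linear_combination sum - dif
  · apply mul_left_cancel₀ n2
    linear_combination sum + dif

lemma rows_series (hν : ∀ q : ℚ, ν + q ≠ 0) (k : ℕ) :
    oddSeries ν k = X * negPow ν * quadSubst (seqSeries (oddCoeff ν k)) ∧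
    evenSeries ν k =
      (1 - PowerSeries.C (1 / 2) * X) * negPow ν * quadSubst (seqSeries (evenCoeff ν k)) := by
  have hg := one_sub_X_mul_negPow_one
  have h4 := C_half_mul_two
  induction k with
  | zero =>
    obtain ⟨h1, h2⟩ := base_series hν
    have h3 := congrArg quadSubst (seqSeries_evenCoeff_zero hν)
    simp only [map_add, map_mul, quadSubst_X, map_ofNat, map_one, quadArg] at h3
    rw [Nat.cast_zero, oddSeries, evenSeries, pow_zero, pow_zero, one_mul]
    refine ⟨h1.symm, ?_⟩
    generalize negPow ν = f at *
    generalize negPow 1 = g at *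
    generalize PowerSeries.C (1 / 2 : ℂ) = c at *
    generalize quadSubst (seqSeries (evenCoeff ν 0)) = R at *
    generalize quadSubst (seqSeries (oddCoeff ν 0)) = P at *
    generalize quadSubst (seqSeries (auxCoeff ν)) = Q at *
    generalize negPow (2 * ν - 1) = F at *
    have e1 : c * ((1 + X) * g) = X * (1 - c * X) * g + c * (1 + X ^ 2 * g) := by
      clear * - hg h4
      grind
    have e2 : c * (1 - 2 * X) = -X * (1 - c * X) * g + c * (1 + X ^ 2 * g) := by
      clear * - hg h4
      grind
    linear_combination F * e1 + e2 - c * (1 - c * X) * f * h3 - X * (1 - c * X) * g * h1 -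
      c * (1 + X ^ 2 * g) * h2 + (1 - c * X) * f * (R - X ^ 2 * g * P) * h4
  | succ k ih =>
    obtain ⟨ih1, ih2⟩ := ih
    have hP := congrArg quadSubst (seqSeries_oddCoeff_succ hν k)
    have hR := congrArg quadSubst (seqSeries_evenCoeff_succ hν k)
    have h7 : PowerSeries.C (7 / 2 : ℂ) = 7 * PowerSeries.C (1 / 2) := by
      rw [show (7 : ℂ⟦X⟧) = PowerSeries.C (7 : ℂ) from (map_ofNat _ 7).symm, ← map_mul]
      norm_num
    rw [h7] at hR
    simp only [map_add, map_sub, map_neg, map_pow, map_mul, quadSubst_X, quadSubst_C, map_ofNat]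
      at hP hR
    rw [Nat.cast_succ, hP, hR, oddSeries_succ, evenSeries_succ, ih1, ih2, quadArg]
    generalize negPow ν = f at *
    generalize negPow 1 = g at *
    generalize PowerSeries.C (1 / 2 : ℂ) = c at *
    generalize quadSubst (seqSeries (evenCoeff ν k)) = R at *
    generalize quadSubst (seqSeries (oddCoeff ν k)) = P at *
    have e1 : 2 * (1 - c * X) ^ 2 * g = 2 + c * (X ^ 2 * g) := by
      clear * - hg h4
      grind
    have e2 : -(c * (X ^ 2 * g)) + 4 * (X * (1 - c * X) * g) ^ 2 =
        7 * c * (X ^ 2 * g) + (X ^ 2 * g) ^ 2 := by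
      clear * - hg h4
      grind
    have e3 : c * (1 - 2 * (X ^ 2 * g)) = c - X ^ 2 * g := by
      clear * - hg h4
      grind
    constructor
    · linear_combination X * f * R * e1
    · linear_combination (1 - c * X) * f * R * e2 + X ^ 2 * g * (1 - c * X) * f * P * e3

/-- The monic polynomials describing the row operations. -/
noncomputable def rowPoly (i : ℕ) : Polynomial ℂ :=
  if i = 0 then 1 else Polynomial.X ^ ((i + 1) / 2 - 1) * (Polynomial.X - Polynomial.C 1) ^
    ((i + 1) / 2) * (if i % 2 = 1 then 1 else Polynomial.X - Polynomial.C (1 / 2))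

lemma rowPoly_monic (i : ℕ) : (rowPoly i).Monic := by
  rw [rowPoly]
  split_ifs
  · exact Polynomial.monic_one
  · exact ((Polynomial.monic_X_pow _).mul ((Polynomial.monic_X_sub_C _).pow _)).mul
      Polynomial.monic_one
  · exact ((Polynomial.monic_X_pow _).mul ((Polynomial.monic_X_sub_C _).pow _)).mul
      (Polynomial.monic_X_sub_C _)

lemma rowPoly_natDegree (i : ℕ) : (rowPoly i).natDegree = i := by
  have h := (Polynomial.monic_X_pow (R := ℂ) ((i + 1) / 2 - 1))
  have h' := (Polynomial.monic_X_sub_C (1 : ℂ)).pow ((i + 1) / 2)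
  rw [rowPoly]
  split_ifs with h0 h1
  · simp [h0]
  · rw [mul_one, h.natDegree_mul h', (Polynomial.monic_X_sub_C (1 : ℂ)).natDegree_pow]
    simp only [Polynomial.natDegree_X_sub_C, Polynomial.natDegree_X_pow]
    omega
  · rw [(h.mul h').natDegree_mul (Polynomial.monic_X_sub_C _), h.natDegree_mul h',
      (Polynomial.monic_X_sub_C (1 : ℂ)).natDegree_pow]
    simp only [Polynomial.natDegree_X_sub_C, Polynomial.natDegree_X_pow]
    omega

/-- The row of the transformed matrix obtained from a polynomial. -/
noncomputable def rowSeries (ν : ℂ) (p : Polynomial ℂ) : ℂ⟦X⟧ :=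
  negPow (2 * ν) * Polynomial.aeval (negPow 1) p - X * Polynomial.aeval (X : ℂ⟦X⟧) p

lemma rowSeries_eq_sum (ν : ℂ) {p : Polynomial ℂ} {n : ℕ} (h : p.natDegree < n) :
    rowSeries ν p = ∑ i ∈ Finset.range n, p.coeff i • (negPow (2 * ν + i) - X ^ (i + 1)) := by
  rw [rowSeries, Polynomial.aeval_eq_sum_range' h, Polynomial.aeval_eq_sum_range' h,
    Finset.mul_sum, Finset.mul_sum, ← Finset.sum_sub_distrib]
  refine Finset.sum_congr rfl fun i _ => ?_
  rw [negPow_add_natCast, smul_sub, mul_smul_comm, mul_smul_comm, pow_succ']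

lemma negPow_two_mul (ν : ℂ) : negPow (2 * ν) = negPow (2 * ν - 1) * negPow 1 := by
  rw [← negPow_add_one, sub_add_cancel]

lemma rowSeries_odd (ν : ℂ) (k : ℕ) :
    rowSeries ν (rowPoly (2 * k + 1)) = oddSeries ν (k + 1) := by
  have hg := one_sub_X_mul_negPow_one
  have e1 : (2 * k + 1 + 1) / 2 = k + 1 := by omega
  rw [rowPoly, if_neg (by omega), if_pos (by omega), e1, rowSeries, oddSeries, negPow_two_mul]
  simp only [Nat.add_sub_cancel, map_mul, map_pow, map_sub, Polynomial.aeval_X, map_one, mul_one]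
  have e2 : negPow 1 - 1 = X * negPow 1 := by linear_combination hg
  rw [e2]
  simp only [mul_pow, pow_succ]
  have e3 : (X - 1 : ℂ⟦X⟧) ^ k = (-1) ^ k * (1 - X) ^ k := by
    rw [← mul_pow, neg_one_mul, neg_sub]
  rw [e3]
  ring

lemma rowSeries_even (ν : ℂ) (k : ℕ) :
    rowSeries ν (rowPoly (2 * (k + 1))) = evenSeries ν (k + 1) := by
  have hg := one_sub_X_mul_negPow_one
  have h4 := C_half_mul_two
  have e1 : (2 * (k + 1) + 1) / 2 = k + 1 := by omega
  rw [rowPoly, if_neg (by omega), if_neg (by omega), e1, rowSeries, evenSeries, negPow_two_mul]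
  simp only [Nat.add_sub_cancel, map_mul, map_pow, map_sub, Polynomial.aeval_X, map_one,
    Polynomial.aeval_C]
  rw [show algebraMap ℂ ℂ⟦X⟧ (1 / 2) = PowerSeries.C (1 / 2) from rfl]
  have e2 : negPow 1 - 1 = X * negPow 1 := by linear_combination hg
  rw [e2]
  generalize PowerSeries.C (1 / 2 : ℂ) = c at *
  generalize negPow (2 * ν - 1) = F at *
  have e3 : (X - 1 : ℂ⟦X⟧) ^ (k + 1) = (-1) ^ (k + 1) * (1 - X) ^ (k + 1) := by
    rw [← mul_pow, neg_one_mul, neg_sub]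
  rw [e3]
  generalize negPow 1 = g at *
  have e4 : g - c = c * ((1 + X) * g) := by
    clear * - hg h4
    grind
  have e5 : (X : ℂ⟦X⟧) - c = -(c * (1 - 2 * X)) := by linear_combination -X * h4
  rw [e4, e5]
  simp only [mul_pow, pow_succ]
  ring

lemma rowSeries_zero (ν : ℂ) : rowSeries ν (rowPoly 0) =
    evenSeries ν 0 + PowerSeries.C (1 / 2) * oddSeries ν 0 := by
  have hg := one_sub_X_mul_negPow_one
  have h4 := C_half_mul_two
  rw [rowPoly, if_pos rfl, rowSeries, evenSeries, oddSeries, negPow_two_mul, map_one, map_one,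
    pow_zero, pow_zero]
  generalize PowerSeries.C (1 / 2 : ℂ) = c at *
  generalize negPow (2 * ν - 1) = F at *
  generalize negPow 1 = g at *
  grind

/-- The column basis. -/
noncomputable def colSeries (ν : ℂ) (m : ℕ) : ℂ⟦X⟧ :=
  (if m % 2 = 1 then X else 1 - PowerSeries.C (1 / 2) * X) * negPow ν * quadArg ^ (m / 2)

lemma colSeries_eq (ν : ℂ) (m : ℕ) : ∃ G : ℂ⟦X⟧, constantCoeff G = 1 ∧
    colSeries ν m = X ^ m * G := by
  have h1 : ∀ c, constantCoeff (negPow c) = 1 := fun c => by simp [negPow, poch]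
  by_cases h : m % 2 = 1
  · refine ⟨negPow ν * negPow 1 ^ (m / 2), by simp [h1], ?_⟩
    conv_rhs => rw [show m = 2 * (m / 2) + 1 by omega]
    rw [colSeries, if_pos h, quadArg, show (2 * (m / 2) + 1) / 2 = m / 2 by omega]
    ring
  · refine ⟨(1 - PowerSeries.C (1 / 2) * X) * negPow ν * negPow 1 ^ (m / 2), by simp [h1], ?_⟩
    conv_rhs => rw [show m = 2 * (m / 2) by omega]
    rw [colSeries, if_neg h, quadArg, show (2 * (m / 2)) / 2 = m / 2 by omega]
    ring

lemma det_colSeries (ν : ℂ) (n : ℕ) :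
    Matrix.det (Matrix.of fun m l : Fin n => coeff (l : ℕ) (colSeries ν m)) = 1 := by
  rw [Matrix.det_of_isUpperTriangular]
  · refine Finset.prod_eq_one fun m _ => ?_
    obtain ⟨G, hG, h⟩ := colSeries_eq ν m
    rw [Matrix.of_apply, h]
    have := coeff_X_pow_mul G (m : ℕ) 0
    rwa [zero_add, coeff_zero_eq_constantCoeff_apply, hG] at this
  · intro m l hml
    obtain ⟨G, -, h⟩ := colSeries_eq ν m
    rw [Matrix.of_apply, h]
    exact X_pow_dvd_iff.1 (dvd_mul_right _ _) _ hml

lemma coeff_mul_quadSubst (H : ℂ⟦X⟧) (a : ℂ → ℂ) {M L l : ℕ} (hL : X ^ L ∣ H * quadArg ^ M)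
    (hl : l < L) : coeff l (H * quadSubst (seqSeries a)) =
      ∑ j ∈ Finset.range M, a j * coeff l (H * quadArg ^ j) := by
  have h1 : quadSubst (trunc M (seqSeries a) : Polynomial ℂ) =
      ∑ j ∈ Finset.range M, PowerSeries.C (a j) * quadArg ^ j := by
    rw [quadSubst, substAlgHom_coe, Polynomial.aeval_def, eval₂_trunc_eq_sum_range]
    refine Finset.sum_congr rfl fun j _ => ?_
    rw [seqSeries, coeff_mk]
    rfl
  rw [eq_X_pow_mul_shift_add_trunc M (seqSeries a), map_add, map_mul quadSubst, map_pow,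
    quadSubst_X, mul_add, ← mul_assoc, map_add, X_pow_dvd_iff.1 (hL.mul_right _) l hl, zero_add, h1,
    Finset.mul_sum,
    map_sum]
  refine Finset.sum_congr rfl fun j _ => ?_
  rw [mul_left_comm, coeff_C_mul]

lemma coeff_oddSeries (hν : ∀ q : ℚ, ν + q ≠ 0) (k : ℕ) {N l : ℕ} (hl : l < 2 * N + 1) :
    coeff l (oddSeries ν k) =
      ∑ j ∈ Finset.range N, oddCoeff ν k j * coeff l (colSeries ν (2 * j + 1)) := by
  rw [(rows_series hν k).1, coeff_mul_quadSubst (M := N) (L := 2 * N + 1) _ _ _ hl]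
  · refine Finset.sum_congr rfl fun j _ => ?_
    rw [colSeries, if_pos (by omega), show (2 * j + 1) / 2 = j by omega]
  · exact ⟨negPow ν * negPow 1 ^ N, by rw [quadArg]; ring⟩

lemma coeff_evenSeries (hν : ∀ q : ℚ, ν + q ≠ 0) (k : ℕ) {N l : ℕ} (hl : l < 2 * N) :
    coeff l (evenSeries ν k) =
      ∑ j ∈ Finset.range N, evenCoeff ν k j * coeff l (colSeries ν (2 * j)) := by
  rw [(rows_series hν k).2, coeff_mul_quadSubst (M := N) (L := 2 * N) _ _ _ hl]
  · refine Finset.sum_congr rfl fun j _ => ?_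
    rw [colSeries, if_neg (by omega), show (2 * j) / 2 = j by omega]
  · exact ⟨(1 - PowerSeries.C (1 / 2) * X) * negPow ν * negPow 1 ^ N, by rw [quadArg]; ring⟩

lemma det_eq_of_mul_eq {n : Type*} [Fintype n] [DecidableEq n] {A B C : Matrix n n ℂ}
    (hA : A.det = 1) (h : A * B = C) : B.det = C.det := by
  rw [← h, Matrix.det_mul, hA, one_mul]

lemma det_eq_of_eq_mul {n : Type*} [Fintype n] [DecidableEq n] {A B C : Matrix n n ℂ}
    (hB : B.det = 1) (h : A = C * B) : A.det = C.det := by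
  rw [h, Matrix.det_mul, hB, mul_one]

lemma bdet_eq_det_rowSeries (ν : ℂ) (n : ℕ) : bdet (2 * ν) n 1 0 =
    Matrix.det (Matrix.of fun i l : Fin n => coeff (l : ℕ) (rowSeries ν (rowPoly i))) := by
  have h1 := Matrix.det_matrixOfPolynomials (fun i : Fin n => rowPoly i)
    (fun i => rowPoly_natDegree i) fun i => rowPoly_monic i
  rw [← Matrix.det_transpose] at h1
  refine det_eq_of_mul_eq h1 ?_
  ext i l
  rw [Matrix.mul_apply, Matrix.of_apply,
    rowSeries_eq_sum ν ((rowPoly_natDegree i).trans_lt i.2), map_sum,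
    ← Fin.sum_univ_eq_sum_range
      (fun m => coeff (l : ℕ) ((rowPoly i).coeff m • (negPow (2 * ν + m) - X ^ (m + 1)))) n]
  refine Finset.sum_congr rfl fun m _ => ?_
  rw [Matrix.transpose_apply, Matrix.of_apply, Matrix.of_apply, map_smul, map_sub, coeff_X_pow,
    negPow, coeff_mk, ← gbinom_eq_poch, smul_eq_mul, zero_add]
  congr 1
  have e : (l : ℕ) = m + 1 ↔ 1 + (m : ℕ) = l := by omega
  have e' : 2 * ν + ((1 + (m : ℕ) : ℕ) : ℂ) + ((l : ℕ) : ℂ) - 2 =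
      2 * ν + (m : ℕ) + (l : ℕ) - 1 := by
    push_cast
    ring
  simp only [e, e']
  split_ifs <;> ring

/-- Splitting `0, …, 2 * N` into odd and even indices. -/
noncomputable def parityEquiv (N : ℕ) : Fin N ⊕ Fin (N + 1) ≃ Fin (2 * N + 1) :=
  Equiv.ofBijective
    (Sum.elim (fun k => ⟨2 * k + 1, by omega⟩) fun k => ⟨2 * k, by omega⟩) <| by
    rw [Fintype.bijective_iff_injective_and_card]
    constructor
    · rintro (a | a) (b | b) h <;> simp [Fin.ext_iff] at h ⊢ <;> omega
    · simp
      ring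

lemma parityEquiv_inl {N : ℕ} (k : Fin N) : (parityEquiv N (Sum.inl k) : ℕ) = 2 * k + 1 := rfl

lemma parityEquiv_inr {N : ℕ} (k : Fin (N + 1)) : (parityEquiv N (Sum.inr k) : ℕ) = 2 * k := rfl

lemma det_rowSeries (hν : ∀ q : ℚ, ν + q ≠ 0) (N : ℕ) :
    Matrix.det (Matrix.of fun i l : Fin (2 * N + 1) =>
      coeff (l : ℕ) (rowSeries ν (rowPoly i))) =
      Matrix.det (Matrix.of fun k j : Fin N => oddCoeff ν ((k : ℕ) + 1) (j : ℕ)) *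
        Matrix.det (Matrix.of fun k j : Fin (N + 1) => evenCoeff ν (k : ℕ) (j : ℕ)) := by
  let C : Matrix (Fin (N + 1)) (Fin N) ℂ :=
    Matrix.of fun k j => if k = 0 then 1 / 2 * oddCoeff ν 0 (j : ℕ) else 0
  rw [← Matrix.det_fromBlocks_zero₁₂ _ C, ← Matrix.det_submatrix_equiv_self (parityEquiv N).symm]
  refine det_eq_of_eq_mul (det_colSeries ν (2 * N + 1)) ?_
  ext i l
  obtain ⟨s, rfl⟩ := (parityEquiv N).surjective i
  rw [Matrix.mul_apply, ← (parityEquiv N).sum_comp, Fintype.sum_sum_type]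
  simp only [Matrix.of_apply, Matrix.submatrix_apply, Equiv.symm_apply_apply]
  have hodd (k : ℕ) := coeff_oddSeries hν k l.2
  have heven (k : ℕ) := coeff_evenSeries hν k (N := N + 1) (l := l) (by omega)
  simp only [← Fin.sum_univ_eq_sum_range
    (fun j => oddCoeff ν _ j * coeff (l : ℕ) (colSeries ν (2 * j + 1)))] at hodd
  simp only [← Fin.sum_univ_eq_sum_range
    (fun j => evenCoeff ν _ j * coeff (l : ℕ) (colSeries ν (2 * j)))] at heven
  rcases s with k | k
  · simp [parityEquiv_inl, rowSeries_odd, hodd]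
  · simp only [parityEquiv_inl, parityEquiv_inr, Matrix.fromBlocks_apply₂₁,
      Matrix.fromBlocks_apply₂₂, Matrix.of_apply, C]
    rcases Fin.eq_zero_or_eq_succ k with rfl | ⟨m, rfl⟩
    · simp [rowSeries_zero, hodd, heven, Finset.mul_sum, mul_assoc, add_comm]
    · simp [rowSeries_even, heven]

lemma oddCoeff_eq (ν k j : ℂ) :
    oddCoeff ν (k + 1) j = (2 * ν + 2 + 3 * k) * gammaEntry (ν + 1) k j := by
  rw [oddCoeff, gammaEntry]
  rw [show ν + (k + 1) + j = ν + 1 + k + j by ring,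
    show 2 * j + 2 - (k + 1) = 2 * j - k + 1 by ring,
    show ν + 2 * (k + 1) - j = ν + 1 + 2 * k - j + 1 by ring]
  ring

lemma bdet_of_generic (hν : ∀ q : ℚ, ν + q ≠ 0) (N : ℕ) :
    bdet (2 * ν) (2 * N + 1) 1 0 =
      ∏ k ∈ Finset.Icc 1 N, Q3 (2 * ν) k * Q4 (2 * ν) k := by
  have hν' : ∀ q : ℚ, ν + 1 + q ≠ 0 := fun q => by
    have := hν (1 + q)
    push_cast at this
    rwa [← add_assoc] at this
  have h1 := det_gammaEntry hν' N
  have h1' := Matrix.det_mul_row (fun j : Fin N => ν + 1 + 3 * ((j : ℕ) : ℂ))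
    (Matrix.of fun k j : Fin N => gammaEntry (ν + 1) (k : ℕ) (j : ℕ))
  rw [Fin.prod_univ_eq_prod_range (fun j => ν + 1 + 3 * (j : ℂ))] at h1'
  replace h1 := h1'.symm.trans h1
  have h2 := det_gammaEntry hν (N + 1)
  have h3 : Matrix.det (Matrix.of fun k j : Fin N => oddCoeff ν ((k : ℕ) + 1) (j : ℕ)) =
      (∏ k : Fin N, (2 * ν + 2 + 3 * ((k : ℕ) : ℂ))) *
        Matrix.det (Matrix.of fun k j : Fin N => gammaEntry (ν + 1) (k : ℕ) (j : ℕ)) := by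
    simp only [oddCoeff_eq]
    exact Matrix.det_mul_column _ _
  have h0 : ∏ j ∈ Finset.range N, (ν + 1 + 3 * (j : ℂ)) ≠ 0 :=
    Finset.prod_ne_zero_iff.2 fun j _ => by
      have := hν' (3 * j)
      push_cast at this
      exact this
  rw [bdet_eq_det_rowSeries, det_rowSeries hν, h3]
  simp only [evenCoeff]
  rw [h2]
  apply mul_left_cancel₀ h0
  have h4 : ∏ k ∈ Finset.Icc 1 N, Q3 (2 * ν) k * Q4 (2 * ν) k =
      ∏ m ∈ Finset.range N, diagRatio ν (m + 1) * Q4 (2 * ν) (m + 1) := by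
    rw [Finset.range_eq_Ico, Finset.prod_Ico_add' (fun k => diagRatio ν k * Q4 (2 * ν) k) 0 N 1]
    refine Finset.prod_congr (by ext; simp) fun k hk => ?_
    rw [diagRatio_eq_Q3 hν (by simp at hk; omega)]
  have h5 : (∏ j ∈ Finset.range N, (2 * ν + 2 + 3 * (j : ℂ))) *
      ∏ j ∈ Finset.range N, diagRatio (ν + 1) j = (∏ j ∈ Finset.range N, (ν + 1 + 3 * (j : ℂ))) *
        ∏ j ∈ Finset.range N, Q4 (2 * ν) (j + 1) := by
    simp only [← Finset.prod_mul_distrib, diagRatio_eq_Q4 hν]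
  rw [Fin.prod_univ_eq_prod_range (fun j => 2 * ν + 2 + 3 * (j : ℂ)), Finset.prod_range_succ' _ N,
    show diagRatio ν 0 = 1 by simp [diagRatio], h4, Finset.prod_mul_distrib]
  linear_combination (∏ j ∈ Finset.range N, diagRatio ν (j + 1)) *
    ((∏ j ∈ Finset.range N, (2 * ν + 2 + 3 * (j : ℂ))) * h1 + h5)

end

lemma continuous_poch (m : ℕ) : Continuous fun x : ℂ => poch x m :=
  continuous_finsetProd _ fun _ _ => by fun_prop

lemma continuous_gbinom (m : ℕ) : Continuous fun x : ℂ => gbinom x m :=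
  (continuous_finsetProd _ fun _ _ => by fun_prop).div_const _

lemma continuous_bdet (n I J : ℕ) : Continuous fun μ : ℂ => bdet μ n I J :=
  Continuous.matrix_det <| continuous_matrix fun _ _ =>
    continuous_const.add ((continuous_gbinom _).comp (by fun_prop))

lemma continuousAt_Q3 {μ : ℂ} {k : ℕ}
    (h : poch ((k : ℂ) + 1) k * poch (μ / 2 + k + 1) k ≠ 0) :
    ContinuousAt (fun μ => Q3 μ k) μ :=
  ContinuousAt.div
    (((continuous_const.mul ((continuous_poch _).comp (by fun_prop))).mul
      ((continuous_poch _).comp (by fun_prop))).continuousAt)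
    ((continuous_const.mul ((continuous_poch _).comp (by fun_prop))).continuousAt) h

lemma continuousAt_Q4 {μ : ℂ} {k : ℕ}
    (h : poch (k : ℂ) (k - 1) * poch (μ / 2 + k + 1) (k - 1) ≠ 0) :
    ContinuousAt (fun μ => Q4 μ k) μ :=
  ContinuousAt.div
    (((continuous_const.mul ((continuous_poch _).comp (by fun_prop))).mul
      ((continuous_poch _).comp (by fun_prop))).continuousAt)
    ((continuous_const.mul ((continuous_poch _).comp (by fun_prop))).continuousAt) h

lemma dense_generic : Dense {μ : ℂ | ∀ q : ℚ, μ / 2 + q ≠ 0} := by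
  refine ((Set.countable_range fun q : ℚ => -2 * (q : ℂ)).dense_compl ℂ).mono fun μ hμ q h => ?_
  exact hμ ⟨q, by linear_combination -2 * h⟩

/-- Theorem (b10), odd case: the determinant `b_n(1,0,μ)`, whenever all
denominators occurring in `Q3`, `Q4` are nonzero. -/
theorem b10_odd (μ : ℂ) (n : ℕ) (hn : 0 < n) (hno : Odd n)
    (h3 : ∀ k ∈ Finset.Icc 1 ((n - 1) / 2),
      poch ((k : ℂ) + 1) k * poch (μ / 2 + k + 1) k ≠ 0)
    (h4 : ∀ k ∈ Finset.Icc 1 ((n - 1) / 2),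
      poch (k : ℂ) (k - 1) * poch (μ / 2 + k + 1) (k - 1) ≠ 0) :
    bdet μ n 1 0 = ∏ k ∈ Finset.Icc 1 ((n - 1) / 2), Q3 μ k * Q4 μ k := by
  obtain ⟨N, rfl⟩ := hno
  rw [show (2 * N + 1 - 1) / 2 = N by omega] at h3 h4 ⊢
  have : (nhdsWithin μ {μ : ℂ | ∀ q : ℚ, μ / 2 + q ≠ 0}).NeBot :=
    mem_closure_iff_nhdsWithin_neBot.1 (dense_generic μ)
  have hright : ContinuousAt (fun μ => ∏ k ∈ Finset.Icc 1 N, Q3 μ k * Q4 μ k) μ :=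
    tendsto_finsetProd _ fun k hk => (continuousAt_Q3 (h3 k hk)).mul (continuousAt_Q4 (h4 k hk))
  refine tendsto_nhds_unique ((continuous_bdet (2 * N + 1) 1 0).continuousAt.tendsto.mono_left
    (nhdsWithin_le_nhds (s := {μ : ℂ | ∀ q : ℚ, μ / 2 + q ≠ 0})))
    ((hright.tendsto.mono_left nhdsWithin_le_nhds).congr' ?_)
  filter_upwards [self_mem_nhdsWithin] with x hx
  simpa only [mul_div_cancel₀ x (two_ne_zero' ℂ)] using (bdet_of_generic hx N).symm
end

section
/- Let F be a field, n ≥ 3, and let A = (a_{i,j})_{1≤i,j≤n} be an n×n matrix over F. Suppose c'_1, …, c'_n ∈ F and c''_1, …, c''_n ∈ F satisfy c'_{n−1} = 1, c'_n = 0, c''_{n−1} = 0, c''_n = 1, and ∑_{j=1}^n a_{i,j} c'_j = ∑_{j=1}^n a_{i,j} c''_j = 0 for all 1 ≤ i ≤ n−2. Then det A = [ ( ∑_{j=1}^n a_{n−1,j} c'_j )( ∑_{j=1}^n a_{n,j} c''_j ) − ( ∑_{j=1}^n a_{n−1,j} c''_j )( ∑_{j=1}^n a_{n,j} c'_j ) ]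 · det A'', where A'' = (a_{i,j})_{1≤i,j≤n−2} is the leading principal (n−2)×(n−2) submatrix of A. -/
/-- Block elimination of the upper right corner: if the columns of `[V; 1]` are annihilated by the
upper block row, the determinant is the product of those of the two remaining diagonal blocks. -/
theorem Matrix.det_fromBlocks_of_mul_add_eq_zero {m k R : Type*} [Fintype m] [DecidableEq m]
    [Fintype k] [DecidableEq k] [CommRing R] (P : Matrix m m R) (Q : Matrix m k R)
    (S : Matrix k m R) (T : Matrix k k R) (V : Matrix m k R) (h : P * V + Q = 0) :
    (Matrix.fromBlocks P Q S T).det = P.det * (S * V + T).det := by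
  have hmul : Matrix.fromBlocks P Q S T * Matrix.fromBlocks 1 V 0 1
      = Matrix.fromBlocks P 0 S (S * V + T) := by
    simp [Matrix.fromBlocks_multiply, h]
  have hdet := congrArg Matrix.det hmul
  rwa [Matrix.det_mul, Matrix.det_fromBlocks_zero₂₁, Matrix.det_fromBlocks_zero₁₂, Matrix.det_one,
    Matrix.det_one, mul_one, mul_one] at hdet

/-- Splitting off the last two terms of a sum over `Fin (n + 3)`. -/
theorem Fin.sum_univ_castLE_add_last_two {M : Type*} [AddCommMonoid M] (n : ℕ)
    (f : Fin (n + 3) → M) :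
    ∑ j, f j = ∑ i : Fin (n + 1), f (Fin.castLE (Nat.le_add_right (n + 1) 2) i)
      + (f ⟨n + 1, Nat.lt_add_of_pos_right two_pos⟩ + f ⟨n + 2, Nat.lt_succ_self _⟩) := by
  rw [Fin.sum_univ_castSucc, Fin.sum_univ_castSucc, add_assoc]
  rfl

/-- Correctness of the double-step variant of Zeilberger's holonomic ansatz:
with two vectors `c'`, `c''` whose last two entries form the identity matrix and
which are orthogonal to all rows of `A` except the last two, the determinant of
`A` is the stated `2×2` determinant times the determinant of the leading
principal submatrix `A''` obtained by deleting the last two rows and columns.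
(The matrix has size `n + 3 ≥ 3`, matching the requirement `n ≥ 3`.) -/
theorem double_step_correctness {F : Type*} [Field F] (n : ℕ)
    (A : Matrix (Fin (n + 3)) (Fin (n + 3)) F)
    (c' c'' : Fin (n + 3) → F)
    (h1 : c' ⟨n + 1, by omega⟩ = 1) (h2 : c' ⟨n + 2, by omega⟩ = 0)
    (h3 : c'' ⟨n + 1, by omega⟩ = 0) (h4 : c'' ⟨n + 2, by omega⟩ = 1)
    (horth' : ∀ i : Fin (n + 1), ∑ j, A (Fin.castLE (by omega) i) j * c' j = 0)
    (horth'' : ∀ i : Fin (n + 1), ∑ j, A (Fin.castLE (by omega) i) j * c'' j = 0) :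
    A.det = ((∑ j, A ⟨n + 1, by omega⟩ j * c' j) * (∑ j, A ⟨n + 2, by omega⟩ j * c'' j)
        - (∑ j, A ⟨n + 1, by omega⟩ j * c'' j) * (∑ j, A ⟨n + 2, by omega⟩ j * c' j))
      * (A.submatrix (fun i : Fin (n + 1) => Fin.castLE (by omega) i)
          (fun j : Fin (n + 1) => Fin.castLE (by omega) j)).det := by
  let e : Fin (n + 1) ⊕ Fin 2 ≃ Fin (n + 3) := finSumFinEquiv
  let V : Matrix (Fin (n + 1)) (Fin 2) F :=
    Matrix.of fun i => ![c' (Fin.castLE (by omega) i), c'' (Fin.castLE (by omega) i)]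
  let B := A.submatrix e e
  have he (i : Fin (n + 1)) : e (Sum.inl i) = Fin.castLE (by omega) i := rfl
  have he0 : e (Sum.inr 0) = ⟨n + 1, by omega⟩ := rfl
  have he1 : e (Sum.inr 1) = ⟨n + 2, by omega⟩ := rfl
  have hV : B.toBlocks₁₁ * V + B.toBlocks₁₂ = 0 := by
    ext i k
    fin_cases k
    · simpa [Fin.sum_univ_castLE_add_last_two, h1, h2, Matrix.mul_apply, Matrix.toBlocks₁₁,
        Matrix.toBlocks₁₂, B, V, he, he0, he1] using horth' i
    · simpa [Fin.sum_univ_castLE_add_last_two, h3, h4, Matrix.mul_apply, Matrix.toBlocks₁₁,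
        Matrix.toBlocks₁₂, B, V, he, he0, he1] using horth'' i
  have hP : B.toBlocks₁₁ = A.submatrix (fun i : Fin (n + 1) => Fin.castLE (by omega) i)
      (fun j : Fin (n + 1) => Fin.castLE (by omega) j) := rfl
  rw [← Matrix.det_submatrix_equiv_self e A, ← Matrix.fromBlocks_toBlocks (A.submatrix e e),
    Matrix.det_fromBlocks_of_mul_add_eq_zero _ _ _ _ V hV, hP, mul_comm, Matrix.det_fin_two]
  simp [Fin.sum_univ_castLE_add_last_two, h1, h2, h3, h4, Matrix.mul_apply, Matrix.toBlocks₂₁,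
    Matrix.toBlocks₂₂, V, he, he0, he1]
end
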